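/- Let $L$ be a linear space of bounded random variables on $(\Omega, \mathcal{A}, P_0)$. There exists a finitely additive probability $P$ on $\mathcal{A}$ with $P \sim P_0$ and $E_P(X) = 0$ for all $X \in L$ if and only if there exist a constant $c > 0$ and a countably additive probability $Q$ on $\mathcal{A}$ with $Q \sim P_0$ such that $c\, E_Q(X) \le \operatorname{ess\,sup}(-X)$ for every $X \in L$. -/

import Mathlib

open MeasureTheory Set

namespace FAP

variable {Ω : Type*}

/-- A finitely additive probability on the power set of `Ω`. -/
def IsFAP (P : Set Ω → ℝ) : Prop :=
  P univ = 1 ∧ (∀ A : Set Ω, 0 ≤ P A) ∧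
    ∀ A B : Set Ω, Disjoint A B → P (A ∪ B) = P A + P B

/-- A finitely additive probability on the σ-field of a measurable space `Ω`. -/
def IsFAPm [MeasurableSpace Ω] (P : Set Ω → ℝ) : Prop :=
  P univ = 1 ∧ (∀ A : Set Ω, MeasurableSet A → 0 ≤ P A) ∧
    ∀ A B : Set Ω, MeasurableSet A → MeasurableSet B → Disjoint A B →
      P (A ∪ B) = P A + P B

/-- The finitely additive integral of a bounded function `X` with respect to a
finitely additive probability `P`, defined via the layer-cake formula
(which agrees with the uniform-limit-of-simple-functions definition). -/
noncomputable def faIntegral (P : Set Ω → ℝ) (X : Ω → ℝ) : ℝ :=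
  (∫ t in Ioi (0 : ℝ), P {ω | t < X ω}) -
    (∫ t in Iio (0 : ℝ), (1 - P {ω | t < X ω}))

/-- `P` is absolutely continuous with respect to the (countably additive) measure `P₀`. -/
def AC [MeasurableSpace Ω] (P : Set Ω → ℝ) (P₀ : Measure Ω) : Prop :=
  ∀ A : Set Ω, MeasurableSet A → P₀ A = 0 → P A = 0

/-- `P` and `P₀` have the same null sets. -/
def EquivP [MeasurableSpace Ω] (P : Set Ω → ℝ) (P₀ : Measure Ω) : Prop :=
  ∀ A : Set Ω, MeasurableSet A → (P A = 0 ↔ P₀ A = 0)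

/-- `P` is pure: the only countably additive measure `Γ` with `0 ≤ Γ ≤ P` is `Γ = 0`. -/
def IsPure [MeasurableSpace Ω] (P : Set Ω → ℝ) : Prop :=
  ∀ Γ : Measure Ω, (∀ A : Set Ω, MeasurableSet A → Γ A ≤ ENNReal.ofReal (P A)) → Γ = 0

/-- The essential supremum `inf {a : P₀(X > a) = 0}` of a random variable `X`. -/
noncomputable def essSupR [MeasurableSpace Ω] (P₀ : Measure Ω) (X : Ω → ℝ) : ℝ :=
  sInf {a : ℝ | P₀ {ω | a < X ω} = 0}

end FAP

open FAP

theorem oneD (p g : ℝ → ℝ) (hp : Antitone p)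
    (hg : ∀ s u, s ≤ u → (u - s) * p u ≤ g u - g s ∧ g u - g s ≤ (u - s) * p s)
    (a b : ℝ) (hab : a ≤ b) : ∫ t in a..b, p t = g b - g a := by
  have hint : ∀ s u, IntervalIntegrable p volume s u := fun s u =>
    hp.intervalIntegrable
  have hI : ∀ s u, s ≤ u → (u - s) * p u ≤ ∫ t in s..u, p t ∧
      ∫ t in s..u, p t ≤ (u - s) * p s := by
    intro s u hsu
    constructor
    · have := intervalIntegral.integral_mono_on hsu (f := fun _ => p u) (g := p)
        (by simp) (hint s u) (fun x hx => hp hx.2)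
      simpa using this
    · have := intervalIntegral.integral_mono_on hsu (f := p) (g := fun _ => p s)
        (hint s u) (by simp) (fun x hx => hp hx.1)
      simpa using this
  have key : ∀ δ : ℝ, 0 ≤ δ → ∀ k : ℕ,
      |(∫ t in a..(a + k * δ), p t) - (g (a + k * δ) - g a)| ≤ δ * (p a - p (a + k * δ)) := by
    intro δ hδ k
    induction k with
    | zero => simp
    | succ k ih =>
      have hle : a + k * δ ≤ a + (k + 1 : ℕ) * δ := by push_cast; nlinarith
      have h1 := hI _ _ hle
      have h2 := hg _ _ hle
      have h3 := intervalIntegral.integral_add_adjacent_intervals (hint a (a + k * δ))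
        (hint (a + k * δ) (a + (k + 1 : ℕ) * δ))
      have h4 : a + (k + 1 : ℕ) * δ - (a + k * δ) = δ := by push_cast; ring
      rw [h4] at h1 h2
      rw [abs_le] at ih ⊢
      constructor <;> linarith [ih.1, ih.2, h1.1, h1.2, h2.1, h2.2]
  have key2 : ∀ n : ℕ, |(∫ t in a..b, p t) - (g b - g a)| ≤
      ((b - a) * (p a - p b)) / ((n : ℝ) + 1) := by
    intro n
    have hn : (0 : ℝ) < (n : ℝ) + 1 := by positivity
    have := key ((b - a) / ((n : ℝ) + 1)) (div_nonneg (by linarith) hn.le) (n + 1)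
    have e : a + ((n + 1 : ℕ) : ℝ) * ((b - a) / ((n : ℝ) + 1)) = b := by
      push_cast; field_simp; ring
    rw [e] at this
    calc _ ≤ _ := this
      _ = _ := by ring
  have hlim : Filter.Tendsto (fun n : ℕ => ((b - a) * (p a - p b)) / ((n : ℝ) + 1))
      Filter.atTop (nhds 0) :=
    by
    have := (tendsto_one_div_add_atTop_nhds_zero_nat (𝕜 := ℝ)).const_mul ((b - a) * (p a - p b))
    simpa [div_eq_mul_inv] using this
  have h0 := ge_of_tendsto' hlim key2
  have := abs_nonpos_iff.mp h0
  linarith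

theorem integral_Ioi_cut (f : ℝ → ℝ) (M : ℝ) (hM : 0 ≤ M) (hf : ∀ t, M ≤ t → f t = 0) :
    ∫ t in Ioi (0 : ℝ), f t = ∫ t in (0 : ℝ)..M, f t := by
  rw [intervalIntegral.integral_of_le hM]
  refine (setIntegral_eq_of_subset_of_forall_sdiff_eq_zero measurableSet_Ioi
    Ioc_subset_Ioi_self ?_)
  rintro x ⟨hx, hx'⟩
  apply hf
  by_contra h
  exact hx' ⟨hx, (not_le.mp h).le⟩

theorem integral_Iio_cut (f : ℝ → ℝ) (M : ℝ) (hM : 0 ≤ M) (hf : ∀ t, t < -M → f t = 0) :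
    ∫ t in Iio (0 : ℝ), f t = ∫ t in (-M)..0, f t := by
  rw [intervalIntegral.integral_of_le (by linarith), integral_Ioc_eq_integral_Ioo,
    ← integral_Ico_eq_integral_Ioo]
  refine (setIntegral_eq_of_subset_of_forall_sdiff_eq_zero measurableSet_Iio
    Ico_subset_Iio_self ?_)
  rintro x ⟨hx, hx'⟩
  apply hf
  by_contra h
  exact hx' ⟨not_lt.mp h, hx⟩

section
variable {Ω : Type*} [MeasurableSpace Ω]

theorem FAP.IsFAPm.empty {P : Set Ω → ℝ} (h : IsFAPm P) : P ∅ = 0 := by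
  have := h.2.2 ∅ ∅ .empty .empty (by simp)
  simp at this; exact this

theorem FAP.IsFAPm.mono {P : Set Ω → ℝ} (h : IsFAPm P) {A B : Set Ω} (hA : MeasurableSet A)
    (hB : MeasurableSet B) (hAB : A ⊆ B) : P A ≤ P B := by
  have := h.2.2 A (B \ A) hA (hB.diff hA) disjoint_sdiff_right
  rw [union_sdiff_cancel hAB] at this
  linarith [h.2.1 _ (hB.diff hA)]

theorem FAP.IsFAPm.compl {P : Set Ω → ℝ} (h : IsFAPm P) {A : Set Ω} (hA : MeasurableSet A) :
    P A + P Aᶜ = 1 := by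
  rw [← h.2.2 A Aᶜ hA hA.compl disjoint_compl_right, union_compl_self, h.1]

theorem FAP.IsFAPm.antitone {P : Set Ω → ℝ} (h : IsFAPm P) {X : Ω → ℝ} (hX : Measurable X) :
    Antitone (fun t => P {ω | t < X ω}) := fun s t hst =>
  h.mono (measurableSet_lt measurable_const hX) (measurableSet_lt measurable_const hX)
    (fun _ hω => lt_of_le_of_lt hst hω)

/-- bounded measurable functions -/
def bddMeas (Ω : Type*) [MeasurableSpace Ω] : Submodule ℝ (Ω → ℝ) where
  carrier := {X | Measurable X ∧ ∃ M : ℝ, ∀ ω, |X ω| ≤ M}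
  add_mem' := by
    rintro X Y ⟨hX, M, hM⟩ ⟨hY, N, hN⟩
    exact ⟨hX.add hY, M + N, fun ω => (abs_add_le _ _).trans (add_le_add (hM ω) (hN ω))⟩
  zero_mem' := ⟨measurable_const, 0, by simp⟩
  smul_mem' := by
    rintro c X ⟨hX, M, hM⟩
    refine ⟨hX.const_smul c, |c| * M, fun ω => ?_⟩
    simp only [Pi.smul_apply, smul_eq_mul, abs_mul]
    exact mul_le_mul_of_nonneg_left (hM ω) (abs_nonneg _)

theorem ind_mem {A : Set Ω} (hA : MeasurableSet A) :
    A.indicator (fun _ => (1 : ℝ)) ∈ bddMeas Ω := by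
  refine ⟨measurable_const.indicator hA, 1, fun ω => ?_⟩
  by_cases h : ω ∈ A <;> simp [h]

theorem const_mem (c : ℝ) : (fun _ => c) ∈ bddMeas Ω :=
  ⟨measurable_const, |c|, fun _ => le_rfl⟩

theorem min_mem {X : Ω → ℝ} (hX : X ∈ bddMeas Ω) (s : ℝ) :
    (fun ω => min (X ω) s) ∈ bddMeas Ω := by
  obtain ⟨hX, M, hM⟩ := hX
  refine ⟨hX.min measurable_const, max M |s|, fun ω => ?_⟩
  rcases min_choice (X ω) s with h | h <;> simp only [h]
  · exact (hM ω).trans (le_max_left _ _)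
  · exact le_max_right _ _

theorem fa_eq (Φ : bddMeas Ω →ₗ[ℝ] ℝ)
    (mono : ∀ X Y : bddMeas Ω, (∀ ω, X.1 ω ≤ Y.1 ω) → Φ X ≤ Φ Y)
    (h1 : Φ ⟨fun _ => 1, const_mem 1⟩ = 1)
    (P : Set Ω → ℝ) (hP : IsFAPm P) (hΦ : ∀ A (hA : MeasurableSet A), P A = Φ ⟨_, ind_mem hA⟩)
    (X : bddMeas Ω) : faIntegral P X.1 = Φ X := by
  obtain ⟨hXm, M₀, hM₀⟩ := X.2
  obtain ⟨M, hM0, hM⟩ : ∃ M : ℝ, 0 ≤ M ∧ ∀ ω, |X.1 ω| ≤ M :=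
    ⟨|M₀|, abs_nonneg _, fun ω => (hM₀ ω).trans (le_abs_self _)⟩
  have hXms : ∀ t : ℝ, MeasurableSet {ω | t < X.1 ω} := fun t =>
    measurableSet_lt measurable_const hXm
  set p : ℝ → ℝ := fun t => P {ω | t < X.1 ω} with hpdef
  have hp : Antitone p := hP.antitone hXm
  let g : ℝ → ℝ := fun s => Φ ⟨_, min_mem X.2 s⟩
  have hg : ∀ s u, s ≤ u → (u - s) * p u ≤ g u - g s ∧ g u - g s ≤ (u - s) * p s := by
    intro s u hsu
    simp only [hpdef, g]
    rw [hΦ _ (hXms u), hΦ _ (hXms s), ← map_sub, ← smul_eq_mul, ← smul_eq_mul, ← map_smul,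
      ← map_smul]
    constructor <;> apply mono <;> intro ω
    · by_cases h : u < X.1 ω
      · simp [h, h.le, hsu.trans h.le]
      · simp [h, min_le_min_left _ hsu]
    · by_cases h : s < X.1 ω
      · simp [h, h.le]
      · simp [h, not_lt.mp h, (not_lt.mp h).trans hsu]
  have hint : ∀ s u, IntervalIntegrable p volume s u := fun s u => hp.intervalIntegrable
  have e1 : ∫ t in Ioi (0 : ℝ), p t = ∫ t in (0 : ℝ)..M, p t := by
    apply integral_Ioi_cut _ _ hM0
    intro t ht
    have : {ω | t < X.1 ω} = ∅ := by
      ext ω; simp; exact ((abs_le.mp (hM ω)).2).trans ht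
    simp only [hpdef, this, hP.empty]
  have e2 : ∫ t in Iio (0 : ℝ), (1 - p t) = ∫ t in (-M)..0, (1 - p t) := by
    apply integral_Iio_cut _ _ hM0
    intro t ht
    have : {ω | t < X.1 ω} = univ := by
      ext ω; simp; exact lt_of_lt_of_le ht ((abs_le.mp (hM ω)).1)
    simp only [hpdef, this, hP.1, sub_self]
  have e3 := intervalIntegral.integral_sub (μ := volume) (a := -M) (b := 0)
    (f := fun _ => (1 : ℝ)) (g := p) (by simp) (hint _ _)
  have e4 := oneD p g hp hg (-M) M (by linarith)
  have e5 := intervalIntegral.integral_add_adjacent_intervals (hint (-M) 0) (hint 0 M)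
  have e6 : g M = Φ X := by
    simp only [g]; congr 1; ext ω; simp [(abs_le.mp (hM ω)).2]
  have e7 : g (-M) = -M := by
    have : g (-M) = Φ ((-M) • ⟨fun _ => 1, const_mem 1⟩) := by
      simp only [g]; congr 1; ext ω; simp [(abs_le.mp (hM ω)).1]
    rw [this, map_smul, h1]; simp
  unfold faIntegral
  change (∫ t in Ioi (0 : ℝ), p t) - (∫ t in Iio (0 : ℝ), (1 - p t)) = _
  rw [e1, e2, e3]
  simp at *
  linarith

variable (P₀ : Measure Ω) [IsProbabilityMeasure P₀]

theorem es_bdd (X : bddMeas Ω) : BddBelow {a : ℝ | P₀ {ω | a < X.1 ω} = 0} := by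
  obtain ⟨hXm, M, hM⟩ := X.2
  refine ⟨-M, fun a ha => ?_⟩
  by_contra h
  have : {ω | a < X.1 ω} = univ := by
    ext ω; simp; exact lt_of_lt_of_le (not_le.mp h) ((abs_le.mp (hM ω)).1)
  rw [mem_ofPred_eq, this] at ha
  simp at ha

theorem es_ne (X : bddMeas Ω) : {a : ℝ | P₀ {ω | a < X.1 ω} = 0}.Nonempty := by
  obtain ⟨hXm, M, hM⟩ := X.2
  refine ⟨M, ?_⟩
  have : {ω | M < X.1 ω} = ∅ := by
    ext ω; simp; exact (abs_le.mp (hM ω)).2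
  simp [this]

theorem es_le (X : bddMeas Ω) (a : ℝ) (h : P₀ {ω | a < X.1 ω} = 0) : essSupR P₀ X.1 ≤ a :=
  csInf_le (es_bdd P₀ X) h

theorem es_add (X Y : bddMeas Ω) :
    essSupR P₀ (X + Y).1 ≤ essSupR P₀ X.1 + essSupR P₀ Y.1 := by
  rw [← sub_le_iff_le_add]
  refine le_csInf (es_ne P₀ X) fun a ha => ?_
  rw [sub_le_comm]
  refine le_csInf (es_ne P₀ Y) fun b hb => ?_
  have := es_le P₀ (X + Y) (a + b) (by
    refine measure_mono_null ?_ (measure_union_null ha hb)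
    intro ω hω
    simp only [mem_ofPred_eq, mem_union, Submodule.coe_add, Pi.add_apply] at hω ⊢
    by_contra! h
    linarith [h.1, h.2])
  linarith

theorem es_smul_le (c : ℝ) (hc : 0 < c) (X : bddMeas Ω) :
    essSupR P₀ (c • X).1 ≤ c * essSupR P₀ X.1 := by
  rw [← div_le_iff₀' hc]
  refine le_csInf (es_ne P₀ X) fun a ha => ?_
  rw [div_le_iff₀' hc]
  apply es_le
  convert ha using 3
  simp [hc]

theorem es_smul (c : ℝ) (hc : 0 < c) (X : bddMeas Ω) :
    essSupR P₀ (c • X).1 = c * essSupR P₀ X.1 := by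
  refine le_antisymm (es_smul_le P₀ c hc X) ?_
  have := es_smul_le P₀ c⁻¹ (inv_pos.mpr hc) (c • X)
  rw [inv_smul_smul₀ hc.ne'] at this
  rwa [le_inv_mul_iff₀ hc] at this

theorem bdd_integrable (Q : Measure Ω) [IsFiniteMeasure Q] (X : bddMeas Ω) :
    Integrable X.1 Q := by
  obtain ⟨hXm, M, hM⟩ := X.2
  exact Integrable.of_bound hXm.aestronglyMeasurable M (Filter.Eventually.of_forall hM)

/-- integral functional -/
noncomputable def intF (Q : Measure Ω) [IsFiniteMeasure Q] : bddMeas Ω →ₗ[ℝ] ℝ where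
  toFun X := ∫ ω, X.1 ω ∂Q
  map_add' X Y := integral_add (bdd_integrable Q X) (bdd_integrable Q Y)
  map_smul' c X := integral_const_mul c X.1

theorem bwd (L : Submodule ℝ (Ω → ℝ))
    (hL : ∀ X ∈ L, Measurable X ∧ ∃ M : ℝ, ∀ ω, |X ω| ≤ M)
    (c : ℝ) (hc : 0 < c) (Q : Measure Ω) [IsProbabilityMeasure Q]
    (hQ : ∀ A : Set Ω, MeasurableSet A → (Q A = 0 ↔ P₀ A = 0))
    (hX : ∀ X ∈ L, c * (∫ ω, X ω ∂Q) ≤ essSupR P₀ (fun ω => -X ω)) :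
    ∃ P : Set Ω → ℝ, IsFAPm P ∧ EquivP P P₀ ∧ ∀ X ∈ L, faIntegral P X = 0 := by
  classical
  let D : Submodule ℝ (bddMeas Ω) := L.comap (bddMeas Ω).subtype
  let f : bddMeas Ω →ₗ.[ℝ] ℝ := ⟨D, (-c) • (intF Q).comp D.subtype⟩
  obtain ⟨φ, hφf, hφ⟩ := exists_extension_of_le_sublinear f (fun X => essSupR P₀ X.1)
    (fun c hc X => es_smul P₀ c hc X) (fun X Y => es_add P₀ X Y) (by
      rintro ⟨X, hXD⟩
      have := hX (-X.1) (L.neg_mem hXD)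
      simp [integral_neg] at this
      change (-c) * (∫ ω, X.1 ω ∂Q) ≤ essSupR P₀ X.1
      linarith)
  have φnonpos : ∀ X : bddMeas Ω, P₀ {ω | 0 < X.1 ω} = 0 → φ X ≤ 0 := fun X h =>
    (hφ X).trans (es_le P₀ X 0 h)
  have φmono : ∀ X Y : bddMeas Ω, (∀ ω, X.1 ω ≤ Y.1 ω) → φ X ≤ φ Y := by
    intro X Y h
    have := φnonpos (X - Y) (by
      have : {ω | 0 < (X - Y).1 ω} = ∅ := by ext ω; simp [h ω]
      rw [this]; simp)
    rw [map_sub] at this; linarith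
  have φ1 : φ ⟨fun _ => 1, const_mem 1⟩ = 1 := by
    apply le_antisymm
    · exact (hφ _).trans (es_le P₀ _ 1 (by simp))
    · have h := (hφ (-⟨fun _ => 1, const_mem 1⟩)).trans (es_le P₀ _ (-1) (by simp))
      rw [map_neg] at h; linarith
  let Φ : bddMeas Ω →ₗ[ℝ] ℝ := (1 + c)⁻¹ • (c • intF Q + φ)
  have Φdef : ∀ X, Φ X = (1 + c)⁻¹ * (c * (∫ ω, X.1 ω ∂Q) + φ X) := fun X => rfl
  have hc1 : 0 < (1 + c)⁻¹ := by positivity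
  have Φmono : ∀ X Y : bddMeas Ω, (∀ ω, X.1 ω ≤ Y.1 ω) → Φ X ≤ Φ Y := by
    intro X Y h
    rw [Φdef, Φdef]
    have := integral_mono (bdd_integrable Q X) (bdd_integrable Q Y) h
    have := φmono X Y h
    gcongr
  have Φ1 : Φ ⟨fun _ => 1, const_mem 1⟩ = 1 := by
    rw [Φdef, φ1]; simp; field_simp; ring
  let P : Set Ω → ℝ := fun A => if hA : MeasurableSet A then Φ ⟨_, ind_mem hA⟩ else 0
  have hPΦ : ∀ A (hA : MeasurableSet A), P A = Φ ⟨_, ind_mem hA⟩ := fun A hA => dif_pos hA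
  have hP : IsFAPm P := by
    refine ⟨?_, ?_, ?_⟩
    · rw [hPΦ _ .univ]; refine Eq.trans ?_ Φ1; congr 1; ext ω; simp
    · intro A hA
      rw [hPΦ _ hA, ← map_zero Φ]
      apply Φmono
      intro ω
      exact indicator_nonneg (fun _ _ => zero_le_one) ω
    · intro A B hA hB hAB
      rw [hPΦ _ hA, hPΦ _ hB, hPΦ _ (hA.union hB), ← map_add]
      congr 1
      ext ω
      simp [indicator_union_of_disjoint hAB]
  refine ⟨P, hP, ?_, ?_⟩
  · intro A hA
    have hi : ∫ ω, A.indicator (fun _ => (1 : ℝ)) ω ∂Q = Q.real A := by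
      rw [integral_indicator hA]; simp
    have hφ0 : 0 ≤ φ ⟨_, ind_mem hA⟩ := by
      rw [← map_zero φ]
      exact φmono _ _ (fun ω => indicator_nonneg (fun _ _ => zero_le_one) ω)
    rw [hPΦ _ hA, Φdef]
    simp only [hi]
    constructor
    · intro h
      rw [← hQ A hA]
      have h' := (mul_eq_zero.mp h).resolve_left hc1.ne'
      have h0 : 0 ≤ c * Q.real A := by positivity
      have h2 : c * Q.real A = 0 := by linarith
      have h3 := (mul_eq_zero.mp h2).resolve_left hc.ne'
      exact (measureReal_eq_zero_iff).mp h3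
    · intro h
      have h1 : Q.real A = 0 := (measureReal_eq_zero_iff).mpr ((hQ A hA).mpr h)
      have h2 := φnonpos ⟨_, ind_mem hA⟩ (measure_mono_null (by
        intro ω hω
        by_contra hn
        simp [hn] at hω) h)
      rw [h1, le_antisymm h2 hφ0]; simp
  · intro X hXL
    rw [fa_eq Φ Φmono Φ1 P hP hPΦ ⟨X, hL X hXL⟩, Φdef]
    have := hφf ⟨⟨X, hL X hXL⟩, hXL⟩
    have h2 : φ ⟨X, hL X hXL⟩ = (-c) * ∫ ω, X ω ∂Q := this
    rw [h2]; simp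

theorem exists_part (P : Set Ω → ℝ) (hP : IsFAPm P) (hE : EquivP P P₀) :
    ∃ μ : Measure Ω, (∀ A, MeasurableSet A → μ A ≤ ENNReal.ofReal (P A)) ∧
      ∀ A, MeasurableSet A → μ A = 0 → P₀ A = 0 := by
  classical
  let m : Set Ω → ENNReal := fun A => if MeasurableSet A then ENNReal.ofReal (P A) else ⊤
  have hm : ∀ A, MeasurableSet A → m A = ENNReal.ofReal (P A) := fun A hA => if_pos hA
  have hm0 : m ∅ = 0 := by rw [hm _ .empty, hP.empty]; simp
  let o := OuterMeasure.ofFunction m hm0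
  have hcar : ‹MeasurableSpace Ω› ≤ o.caratheodory := by
    intro s hs
    apply OuterMeasure.ofFunction_caratheodory
    intro t
    by_cases ht : MeasurableSet t
    · rw [hm _ ht, hm _ (ht.inter hs), hm _ (ht.diff hs), ← ENNReal.ofReal_add
        (hP.2.1 _ (ht.inter hs)) (hP.2.1 _ (ht.diff hs)), ← hP.2.2 _ _ (ht.inter hs) (ht.diff hs)
        (disjoint_sdiff_right.mono_left inter_subset_right), inter_union_sdiff]
    · simp [m, ht]
  refine ⟨o.toMeasure hcar, ?_, ?_⟩
  · intro A hA
    rw [toMeasure_apply _ _ hA, ← hm A hA]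
    exact OuterMeasure.ofFunction_le A
  · intro A hA h0
    rw [toMeasure_apply _ _ hA] at h0
    by_contra hA0
    -- covers
    have cover : ∀ ε : ℝ, 0 < ε → ∀ δ : ENNReal, δ ≠ 0 → ∃ F, MeasurableSet F ∧ P F ≤ ε ∧
        P₀ (A \ F) ≤ δ := by
      intro ε hε δ hδ
      have h0' : o A < ENNReal.ofReal ε := by rw [h0]; simpa using hε
      rw [OuterMeasure.ofFunction_apply] at h0'
      simp only [iInf_lt_iff] at h0'
      obtain ⟨t, htA, ht⟩ := h0'
      have htm : ∀ n, MeasurableSet (t n) := by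
        intro n
        by_contra hn
        have : m (t n) ≤ ∑' n, m (t n) := ENNReal.le_tsum n
        have h2 : m (t n) = ⊤ := if_neg hn
        rw [h2, top_le_iff] at this
        rw [this] at ht
        simp at ht
      have hFm : ∀ n, MeasurableSet (partialSups t n) := fun n => by
        rw [partialSups_eq_biUnion_range]
        exact Finset.measurableSet_biUnion _ (fun i _ => htm i)
      have hPF : ∀ n, ENNReal.ofReal (P (partialSups t n)) ≤ 
          ∑ k ∈ Finset.range (n + 1), m (t k) := by
        intro n
        induction n with
        | zero => simp [hm _ (htm 0)]
        | succ n ih =>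
          rw [Finset.sum_range_succ, hm _ (htm (n + 1))]
          refine le_trans ?_ (add_le_add_left ih _)
          rw [← ENNReal.ofReal_add (hP.2.1 _ (hFm n)) (hP.2.1 _ (htm _))]
          apply ENNReal.ofReal_le_ofReal
          have e : partialSups t (n + 1) = partialSups t n ∪ (t (n + 1) \ partialSups t n) := by
            rw [union_sdiff_self]
            exact partialSups_add_one t n
          rw [e, hP.2.2 _ _ (hFm n) ((htm _).diff (hFm n)) disjoint_sdiff_right]
          have := hP.mono ((htm (n + 1)).diff (hFm n)) (htm (n + 1)) diff_subset
          linarith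
      have htend : Filter.Tendsto (fun n => P₀ (A \ partialSups t n)) Filter.atTop (nhds 0) := by
        have := tendsto_measure_iInter_atTop (μ := P₀) (s := fun n => A \ partialSups t n)
          (fun n => (hA.diff (hFm n)).nullMeasurableSet)
          (fun i j hij => sdiff_subset_sdiff_right ((partialSups t).monotone hij))
          ⟨0, measure_ne_top _ _⟩
        have e : (⋂ n, A \ partialSups t n) = ∅ := by
          rw [← sdiff_iUnion, sdiff_eq_empty]
          refine htA.trans (iUnion_mono fun n => le_partialSups t n)
        rwa [e, measure_empty] at this
      obtain ⟨n, hn⟩ := (htend.eventually_lt_const (pos_iff_ne_zero.mpr hδ)).exists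
      refine ⟨partialSups t n, hFm n, ?_, hn.le⟩
      have := ((hPF n).trans (ENNReal.sum_le_tsum _)).trans ht.le
      exact (ENNReal.ofReal_le_ofReal_iff hε.le).mp this
    obtain ⟨δ, hδpos, hδ⟩ := ENNReal.exists_pos_sum_of_countable' hA0 ℕ
    choose F hFm hFP hF0 using fun n : ℕ => cover (1 / ((n : ℝ) + 1)) (by positivity) (δ n)
      (hδpos n).ne'
    have hC : MeasurableSet (⋂ n, F n) := .iInter hFm
    have hPC : P (⋂ n, F n) = 0 := by
      apply le_antisymm _ (hP.2.1 _ hC)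
      refine ge_of_tendsto' tendsto_one_div_add_atTop_nhds_zero_nat fun n => ?_
      exact (hP.mono hC (hFm n) (iInter_subset _ n)).trans (hFP n)
    have h0C : P₀ (⋂ n, F n) = 0 := (hE _ hC).mp hPC
    have : P₀ A < P₀ A := calc
      P₀ A ≤ P₀ ((⋂ n, F n) ∪ ⋃ n, (A \ F n)) := by
        apply measure_mono
        rw [← sdiff_iInter]
        intro ω hω
        by_cases h : ω ∈ ⋂ n, F n
        · exact Or.inl h
        · exact Or.inr ⟨hω, h⟩
      _ ≤ P₀ (⋂ n, F n) + P₀ (⋃ n, (A \ F n)) := measure_union_le _ _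
      _ ≤ ∑' n, δ n := by
        rw [h0C, zero_add]
        exact (measure_iUnion_le _).trans (ENNReal.tsum_le_tsum hF0)
      _ < P₀ A := hδ
    exact lt_irrefl _ this

theorem fwd_ineq (P : Set Ω → ℝ) (hP : IsFAPm P) (hE : EquivP P P₀) (μ : Measure Ω)
    [IsFiniteMeasure μ] (hμ : ∀ A, MeasurableSet A → μ A ≤ ENNReal.ofReal (P A))
    (X : Ω → ℝ) (hX : X ∈ bddMeas Ω) (h0 : faIntegral P X = 0) :
    ∫ ω, X ω ∂μ ≤ essSupR P₀ (fun ω => -X ω) := by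
  refine le_csInf (es_ne P₀ (-⟨X, hX⟩)) fun a ha => ?_
  obtain ⟨hXm, M₀, hM₀⟩ := id hX
  obtain ⟨M, hM0, hMa, hM⟩ : ∃ M : ℝ, 0 ≤ M ∧ |a| ≤ M ∧ ∀ ω, |X ω| ≤ M :=
    ⟨max |M₀| |a|, (abs_nonneg _).trans (le_max_left _ _), le_max_right _ _, fun ω =>
      (hM₀ ω).trans ((le_abs_self _).trans (le_max_left _ _))⟩
  have hXms : ∀ t : ℝ, MeasurableSet {ω | t < X ω} := fun t =>
    measurableSet_lt measurable_const hXm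
  set p : ℝ → ℝ := fun t => P {ω | t < X ω} with hpdef
  have hp : Antitone p := hP.antitone hXm
  have hint : ∀ s u, IntervalIntegrable p volume s u := fun s u => hp.intervalIntegrable
  have hpn : ∀ t, 0 ≤ p t := fun t => hP.2.1 _ (hXms t)
  have hp1 : ∀ t, t < -a → p t = 1 := by
    intro t ht
    have := hP.compl (hXms t)
    have h2 : P {ω | t < X ω}ᶜ = 0 := by
      rw [hE _ (hXms t).compl]
      refine measure_mono_null ?_ ha
      intro ω hω
      simp at hω ⊢
      linarith
    simp only [hpdef]; linarith
  have e1 : ∫ t in Ioi (0 : ℝ), p t = ∫ t in (0 : ℝ)..M, p t := by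
    apply integral_Ioi_cut _ _ hM0
    intro t ht
    have : {ω | t < X ω} = ∅ := by
      ext ω; simp; exact ((abs_le.mp (hM ω)).2).trans ht
    simp only [hpdef, this, hP.empty]
  have h0' : (∫ t in (0 : ℝ)..M, p t) - (∫ t in Iio (0 : ℝ), (1 - p t)) = 0 := by
    rw [← e1]; exact h0
  have ha0 : 0 ≤ a := by
    by_contra! han
    have z : ∫ t in Iio (0 : ℝ), (1 - p t) = 0 := by
      rw [integral_Iio_cut _ 0 le_rfl]
      · simp
      · intro t ht; rw [hp1 t (by linarith)]; simp
    rw [z, sub_zero, ← intervalIntegral.integral_add_adjacent_intervals (hint 0 (-a / 2))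
      (hint (-a / 2) M)] at h0'
    have i1 : 0 ≤ ∫ t in (-a / 2)..M, p t :=
      intervalIntegral.integral_nonneg (by linarith [neg_le_abs a]) (fun t _ => hpn t)
    have i2 := intervalIntegral.integral_mono_on (a := 0) (b := -a / 2) (by linarith)
      (f := fun _ => p (-a / 2)) (g := p) (by simp) (hint _ _) (fun x hx => hp hx.2)
    rw [hp1 (-a / 2) (by linarith)] at i2
    simp at i2
    linarith
  have z : ∫ t in Iio (0 : ℝ), (1 - p t) ≤ a := by
    rw [integral_Iio_cut _ a ha0 (fun t ht => by rw [hp1 t ht]; simp)]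
    have := intervalIntegral.integral_mono_on (a := -a) (b := 0) (by linarith)
      (f := fun t => 1 - p t) (g := fun _ => 1)
      (by simpa using (intervalIntegrable_const (c := (1:ℝ))).sub (hint (-a) 0)) (by simp)
      (fun x _ => by linarith [hpn x])
    simpa using this
  have hX' : Integrable X μ := bdd_integrable μ ⟨X, hX⟩
  have hXp : Integrable (fun ω => max (X ω) 0) μ := hX'.pos_part
  calc ∫ ω, X ω ∂μ ≤ ∫ ω, max (X ω) 0 ∂μ := integral_mono hX' hXp (fun ω => le_max_left _ _)
    _ = ∫ t in Ioi (0 : ℝ), μ.real {ω | t < max (X ω) 0} :=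
      hXp.integral_eq_integral_meas_lt (Filter.Eventually.of_forall fun ω => le_max_right _ _)
    _ ≤ ∫ t in Ioi (0 : ℝ), p t := by
      apply integral_mono_of_nonneg
      · exact Filter.Eventually.of_forall fun t => measureReal_nonneg
      · change IntegrableOn p (Ioi 0) volume
        refine IntegrableOn.of_forall_sdiff_eq_zero
          ((intervalIntegrable_iff_integrableOn_Ioc_of_le hM0).mp (hint 0 M)) measurableSet_Ioi ?_
        rintro t ⟨ht, ht'⟩
        have hMt : M ≤ t := by
          by_contra h
          exact ht' ⟨ht, (not_le.mp h).le⟩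
        have : {ω | t < X ω} = ∅ := by
          ext ω; simp; exact ((abs_le.mp (hM ω)).2).trans hMt
        simp only [hpdef, this, hP.empty]
      · refine (ae_restrict_iff' measurableSet_Ioi).mpr (Filter.Eventually.of_forall ?_)
        intro t ht
        have : {ω | t < max (X ω) 0} = {ω | t < X ω} := by
          ext ω; simp [not_lt.mpr (le_of_lt (mem_Ioi.mp ht))]
        simp only [this]
        exact ENNReal.toReal_le_of_le_ofReal (hpn t) (hμ _ (hXms t))
    _ ≤ a := by rw [e1]; linarith

end

/-- there is a finitely additive probability P with P ∼ P₀ and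
E_P(X) = 0 for all X ∈ L iff there are c > 0 and a countably additive probability
Q ∼ P₀ with c E_Q(X) ≤ ess sup(-X) for every X ∈ L. -/
theorem stmt8 {Ω : Type*} [MeasurableSpace Ω] (P₀ : Measure Ω) [IsProbabilityMeasure P₀]
    (L : Submodule ℝ (Ω → ℝ))
    (hL : ∀ X ∈ L, Measurable X ∧ ∃ M : ℝ, ∀ ω, |X ω| ≤ M) :
    (∃ P : Set Ω → ℝ, FAP.IsFAPm P ∧ FAP.EquivP P P₀ ∧
        ∀ X ∈ L, FAP.faIntegral P X = 0)
    ↔ ∃ c : ℝ, 0 < c ∧ ∃ Q : Measure Ω, IsProbabilityMeasure Q ∧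
        (∀ A : Set Ω, MeasurableSet A → (Q A = 0 ↔ P₀ A = 0)) ∧
        ∀ X ∈ L, c * (∫ ω, X ω ∂Q) ≤ FAP.essSupR P₀ (fun ω => -X ω) := by
  constructor
  · rintro ⟨P, hP, hE, hX⟩
    obtain ⟨μ, hμ, hμ0⟩ := exists_part P₀ P hP hE
    have hfin : IsFiniteMeasure μ := ⟨(hμ _ .univ).trans_lt ENNReal.ofReal_lt_top⟩
    have hne : μ univ ≠ 0 := fun h => by simpa using hμ0 _ .univ h
    have hne' : μ univ ≠ ⊤ := measure_ne_top _ _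
    refine ⟨μ.real univ, ENNReal.toReal_pos hne hne', (μ univ)⁻¹ • μ, ⟨?_⟩, ?_, ?_⟩
    · simp [ENNReal.inv_mul_cancel hne hne']
    · intro A hA
      have : ((μ univ)⁻¹ • μ) A = 0 ↔ μ A = 0 := by simp [hne']
      rw [this]
      refine ⟨hμ0 A hA, fun h => ?_⟩
      have := hμ A hA
      rw [(hE A hA).mpr h] at this
      simpa using this
    · intro X hXL
      have := fwd_ineq P₀ P hP hE μ hμ X (hL X hXL) (hX X hXL)
      rw [integral_smul_measure, ENNReal.toReal_inv, smul_eq_mul]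
      change (μ univ).toReal * _ ≤ _
      rw [mul_inv_cancel_left₀ (ENNReal.toReal_pos hne hne').ne']
      exact this
  · rintro ⟨c, hc, Q, hQ, hQ0, hX⟩
    exact bwd P₀ L hL c hc Q hQ0 hX
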